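/- Let k be a field, n ≥ 1, and I ⊆ {1,…,n−1}. Let P_I be the set of invertible n×n matrices g over k such that g_{ij} = 0 whenever i > j and there exists c with j ≤ c ≤ i−1 and c ∉ I (the block upper triangular matrices whose diagonal blocks are the intervals cut between positions c and c+1 for each c ∉ I), and let W_I be the subgroup of the symmetric group S_n generated by the adjacent transpositions (c, c+1) with c ∈ I. Then for permutations σ, σ' of {1,…,n}, the permutation matrix P_{σ'} can be written as L · P_σ · p with L an invertible lower triangular matrix over k and p ∈ P_I if and only if σ⁻¹σ' ∈ W_I. -/

import Mathlib

/-- The permutation matrix of `σ`: the `(i,j)` entry is `1` if `i = σ j` and `0` otherwise. -/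
def permMat {k : Type*} [Field k] {n : ℕ} (σ : Equiv.Perm (Fin n)) :
    Matrix (Fin n) (Fin n) k :=
  Matrix.of fun i j => if i = σ j then 1 else 0

lemma permMat_mul_apply {k : Type*} [Field k] {n : ℕ} (σ : Equiv.Perm (Fin n))
    (A : Matrix (Fin n) (Fin n) k) (i j : Fin n) :
    (permMat σ * A : Matrix (Fin n) (Fin n) k) (σ i) j = A i j := by
  simp [Matrix.mul_apply, permMat]

lemma mul_permMat_apply {k : Type*} [Field k] {n : ℕ} (σ : Equiv.Perm (Fin n))
    (A : Matrix (Fin n) (Fin n) k) (i j : Fin n) :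
    (A * permMat σ : Matrix (Fin n) (Fin n) k) i j = A i (σ j) := by
  simp [Matrix.mul_apply, permMat]

lemma permMat_mul {k : Type*} [Field k] {n : ℕ} (σ τ : Equiv.Perm (Fin n)) :
    (permMat (σ * τ) : Matrix (Fin n) (Fin n) k) = permMat σ * permMat τ := by
  ext i j
  rw [mul_permMat_apply]
  rfl

lemma permMat_one {k : Type*} [Field k] {n : ℕ} :
    (permMat 1 : Matrix (Fin n) (Fin n) k) = 1 := by
  ext i j
  rw [Matrix.one_apply]
  rfl

lemma isUnit_permMat {k : Type*} [Field k] {n : ℕ} (σ : Equiv.Perm (Fin n)) :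
    IsUnit (permMat σ : Matrix (Fin n) (Fin n) k) :=
  IsUnit.of_mul_eq_one (permMat σ⁻¹) (by rw [← permMat_mul, mul_inv_cancel, permMat_one])

/-- The inverse of an invertible lower triangular matrix has nonzero diagonal entries. -/
lemma inv_diag_ne_zero_of_lowerTriangular {k : Type*} [Field k] {n : ℕ}
    {L : Matrix (Fin n) (Fin n) k} (hL : IsUnit L) (hlow : ∀ i j : Fin n, i < j → L i j = 0)
    (i : Fin n) : L⁻¹ i i ≠ 0 := by
  have htri : L.BlockTriangular OrderDual.toDual := fun i j hij => hlow i j hij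
  have := hL.invertible
  have hinv := Matrix.blockTriangular_inv_of_blockTriangular htri
  have hdet : L⁻¹.det ≠ 0 :=
    ((Matrix.isUnit_iff_isUnit_det _).1 (Matrix.isUnit_nonsing_inv_iff.2 hL)).ne_zero
  rw [Matrix.det_of_isLowerTriangular _ hinv] at hdet
  exact Finset.prod_ne_zero_iff.1 hdet i (Finset.mem_univ i)

/-- The adjacent transpositions `(c, c+1)` with `c ∈ I` generate the permutations that preserve
every initial segment `{0, …, c}` with `c ∉ I`. -/
lemma mem_closure_adjacent_swaps_iff {n : ℕ} (I : Set ℕ) (hI : ∀ c ∈ I, c + 1 < n)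
    (w : Equiv.Perm (Fin n)) :
    w ∈ Subgroup.closure
          {τ : Equiv.Perm (Fin n) | ∃ c : ℕ, ∃ hc : c ∈ I,
            τ = Equiv.swap ⟨c, Nat.lt_of_succ_lt (hI c hc)⟩ ⟨c + 1, hI c hc⟩} ↔
      ∀ c ∉ I, ∀ j : Fin n, (j : ℕ) ≤ c → (w j : ℕ) ≤ c := by
  have inv_le : ∀ (c : ℕ) (v : Equiv.Perm (Fin n)),
      (∀ j : Fin n, (j : ℕ) ≤ c → (v j : ℕ) ≤ c) →
        ∀ j : Fin n, (j : ℕ) ≤ c → (v⁻¹ j : ℕ) ≤ c := by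
    intro c v hv j hj
    have hmap : ({j : Fin n | (j : ℕ) ≤ c} : Finset (Fin n)).map v.toEmbedding =
        ({j : Fin n | (j : ℕ) ≤ c} : Finset (Fin n)) :=
      Finset.map_eq_of_subset fun x hx => by
        obtain ⟨y, hy, rfl⟩ := Finset.mem_map.1 hx
        simpa using hv y (by simpa using hy)
    have hj' : j ∈ ({j : Fin n | (j : ℕ) ≤ c} : Finset (Fin n)) := by simpa using hj
    rw [← hmap] at hj'
    obtain ⟨y, hy, rfl⟩ := Finset.mem_map.1 hj'
    simpa using hy
  constructor
  · intro hw c hc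
    induction hw using Subgroup.closure_induction with
    | mem τ hτ =>
      obtain ⟨d, hd, rfl⟩ := hτ
      intro j hj
      have hdc : d ≠ c := fun h => hc (h ▸ hd)
      rw [Equiv.swap_apply_def]
      split_ifs with h₁ h₂
      · rw [h₁] at hj
        dsimp at hj ⊢
        omega
      · rw [h₂] at hj
        dsimp at hj ⊢
        omega
      · exact hj
    | one => simp
    | mul x y _ _ hx hy => exact fun j hj => hx _ (hy j hj)
    | inv x _ hx => exact inv_le c x hx
  · intro hw
    rw [mem_closure_isSwap]
    swap
    · rintro _ ⟨c, hc, rfl⟩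
      exact ⟨_, _, by simp, rfl⟩
    refine ⟨Set.toFinite _, fun x => ?_⟩
    set H := Subgroup.closure
          {τ : Equiv.Perm (Fin n) | ∃ c : ℕ, ∃ hc : c ∈ I,
            τ = Equiv.swap ⟨c, Nat.lt_of_succ_lt (hI c hc)⟩ ⟨c + 1, hI c hc⟩} with hH
    have chain : ∀ (a b : ℕ) (hab : a ≤ b) (hb : b < n), (∀ c, a ≤ c → c < b → c ∈ I) →
        (⟨b, hb⟩ : Fin n) ∈ MulAction.orbit H (⟨a, hab.trans_lt hb⟩ : Fin n) := by
      intro a b hab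
      induction b, hab using Nat.le_induction with
      | base => exact fun _ _ => MulAction.mem_orbit_self _
      | succ b hab ih =>
        intro hb hc
        have hbI := hc b hab (Nat.lt_succ_self b)
        obtain ⟨g, hg⟩ := ih (by omega) fun c h₁ h₂ => hc c h₁ (by omega)
        refine ⟨⟨_, Subgroup.subset_closure ⟨b, hbI, rfl⟩⟩ * g, ?_⟩
        dsimp only at hg ⊢
        rw [mul_smul, hg]
        exact Equiv.swap_apply_left _ _
    rcases le_total x (w x) with h | h
    · refine chain x (w x) h (w x).2 fun c h₁ h₂ => ?_
      by_contra hc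
      exact absurd (hw c hc x h₁) (by omega)
    · refine MulAction.mem_orbit_symm.1 (chain (w x) x h x.2 fun c h₁ h₂ => ?_)
      by_contra hc
      have := inv_le c w (hw c hc) (w x) h₁
      rw [← Equiv.Perm.mul_apply, inv_mul_cancel, Equiv.Perm.one_apply] at this
      omega

/-- Bruhat decomposition relative to a standard parabolic subgroup of `GL_n`
(indices written `0,…,n-1`; `I` is a set of cut positions `c` with `c + 1 < n`).
`P_I` consists of the invertible block upper triangular matrices `p` with
`p i j = 0` whenever there is a cut `c ∉ I` with `j ≤ c < i`, and `W_I` is the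
subgroup of `S_n` generated by the adjacent transpositions `(c, c+1)` with `c ∈ I`.
Then `P_{σ'} ∈ B⁻ · P_σ · P_I` if and only if `σ⁻¹ σ' ∈ W_I`. -/
theorem bruhat_parabolic {k : Type*} [Field k] {n : ℕ} (hn : 1 ≤ n)
    (I : Set ℕ) (hI : ∀ c ∈ I, c + 1 < n) (σ σ' : Equiv.Perm (Fin n)) :
    (∃ L p : Matrix (Fin n) (Fin n) k,
        IsUnit L ∧ (∀ i j : Fin n, i < j → L i j = 0) ∧
        IsUnit p ∧
        (∀ i j : Fin n, (∃ c : ℕ, (j : ℕ) ≤ c ∧ c < (i : ℕ) ∧ c ∉ I) → p i j = 0) ∧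
        permMat σ' = L * permMat σ * p)
      ↔ σ⁻¹ * σ' ∈ Subgroup.closure
          {τ : Equiv.Perm (Fin n) | ∃ c : ℕ, ∃ hc : c ∈ I,
            τ = Equiv.swap ⟨c, Nat.lt_of_succ_lt (hI c hc)⟩ ⟨c + 1, hI c hc⟩} := by
  rw [mem_closure_adjacent_swaps_iff]
  constructor
  · rintro ⟨L, p, hL, hlow, -, hp, h⟩ c hc j hj
    by_contra hlt
    apply inv_diag_ne_zero_of_lowerTriangular hL hlow (σ' j)
    have hmul :
        (L⁻¹ * permMat σ' : Matrix (Fin n) (Fin n) k) = permMat σ * p := by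
      rw [h, mul_assoc, Matrix.nonsing_inv_mul_cancel_left _ _
        ((Matrix.isUnit_iff_isUnit_det _).1 hL)]
    rw [← mul_permMat_apply σ' L⁻¹, hmul, show σ' j = σ ((σ⁻¹ * σ') j) by simp, permMat_mul_apply]
    exact hp _ _ ⟨c, hj, not_le.1 hlt, hc⟩
  · intro hw
    refine ⟨1, permMat (σ⁻¹ * σ'), isUnit_one, fun i j hij => Matrix.one_apply_ne hij.ne,
      isUnit_permMat _, ?_, ?_⟩
    · rintro i j ⟨c, hj, hi, hc⟩
      refine if_neg ?_
      rintro rfl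
      exact absurd (hw c hc j hj) (not_le.2 hi)
    · rw [one_mul, ← permMat_mul, mul_inv_cancel_left]
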